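/- Assume the Riemann hypothesis (all nontrivial zeros of the Riemann zeta function have real part 1/2). Let ξ : ℂ → ℂ be the Riemann xi function, defined by ξ(s) = (s·(s−1)/2)·Λ₀(s) + 1/2, where Λ₀ is the entire completed Riemann zeta function (Mathlib's completedRiemannZeta₀). Then every zero of ξ′ lies on the critical line: if deriv ξ(s) = 0 then Re s = 1/2. -/

import Mathlib

/-- The Riemann xi function. -/
noncomputable def riemannXi (s : ℂ) : ℂ :=
  s * (s - 1) / 2 * completedRiemannZeta₀ s + 1 / 2

lemma xiaux_single (a : ℂ) : ∀ (n : ℕ) (f : ℂ → ℂ), Differentiable ℂ f → analyticOrderAt f a = n →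
    ∃ g : ℂ → ℂ, Differentiable ℂ g ∧ g a ≠ 0 ∧ ∀ z, f z = (z - a) ^ n * g z := by
  intro n
  induction n with
  | zero =>
    intro f hf h
    refine ⟨f, hf, ?_, by simp⟩
    exact ((hf.analyticAt a).analyticOrderAt_eq_zero).1 (by simpa using h)
  | succ n ih =>
    intro f hf h
    have hfa : f a = 0 := by
      by_contra h0
      have := ((hf.analyticAt a).analyticOrderAt_eq_zero).2 h0
      rw [this] at h
      exact absurd h (by norm_cast)
    have hg : Differentiable ℂ (dslope f a) := by
      rw [← differentiableOn_univ] at hf ⊢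
      exact (Complex.differentiableOn_dslope Filter.univ_mem).2 hf
    have hfg : ∀ z, f z = (z - a) * dslope f a z := by
      intro z
      have := sub_smul_dslope f a z
      rw [hfa, sub_zero, smul_eq_mul] at this
      exact this.symm
    have hid : Differentiable ℂ (fun z : ℂ => z - a) := by fun_prop
    have h1 : analyticOrderAt (fun z : ℂ => z - a) a = 1 := by
      have := (hid.analyticAt a).analyticOrderAt_eq_natCast (n := 1)
      refine this.2 ⟨fun _ => 1, analyticAt_const, one_ne_zero, ?_⟩
      simp
    have hmul : analyticOrderAt f a = 1 + analyticOrderAt (dslope f a) a := by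
      rw [← h1, ← analyticOrderAt_mul (hid.analyticAt a) (hg.analyticAt a)]
      congr 1
      ext z
      exact hfg z
    have hord : analyticOrderAt (dslope f a) a = n := by
      rw [h] at hmul
      push_cast at hmul
      rw [add_comm] at hmul
      exact ENat.add_right_injective_of_ne_top (n := 1) (by simp) hmul.symm
    obtain ⟨g, hg1, hg2, hg3⟩ := ih _ hg hord
    refine ⟨g, hg1, hg2, fun z => ?_⟩
    rw [hfg, hg3]; ring

lemma xiaux_factor (f : ℂ → ℂ) (hf : Differentiable ℂ f) (h0 : f 0 ≠ 0) (Z : Finset ℂ) :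
    ∃ (n : ℂ → ℕ) (g : ℂ → ℂ), Differentiable ℂ g ∧ (∀ a ∈ Z, g a ≠ 0) ∧
      ∀ z, f z = (∏ a ∈ Z, (z - a) ^ n a) * g z := by
  classical
  induction Z using Finset.induction_on with
  | empty => exact ⟨fun _ => 0, f, hf, by simp, by simp⟩
  | insert b Z hb ih =>
    obtain ⟨n, g, hg, hgZ, hfg⟩ := ih
    have hg0 : g 0 ≠ 0 := by
      intro h
      apply h0
      rw [hfg, h, mul_zero]
    have htop : analyticOrderAt g b ≠ ⊤ := by
      intro h
      have h1 := analyticOrderAt_eq_top.1 h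
      have h2 := AnalyticOnNhd.eq_of_eventuallyEq (f := g) (g := fun _ => 0)
        (fun z _ => hg.analyticAt z) (fun z _ => analyticAt_const) h1
      exact hg0 (congrFun h2 0)
    obtain ⟨k, hk⟩ := ENat.ne_top_iff_exists.1 htop
    obtain ⟨G, hG, hGb, hgG⟩ := xiaux_single b k g hg hk.symm
    refine ⟨Function.update n b k, G, hG, ?_, ?_⟩
    · intro a ha
      rcases Finset.mem_insert.1 ha with rfl | ha
      · exact hGb
      · intro h
        apply hgZ a ha
        rw [hgG, h, mul_zero]
    · intro z
      rw [Finset.prod_insert hb, hfg, hgG]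
      have : ∏ a ∈ Z, (z - a) ^ (Function.update n b k) a = ∏ a ∈ Z, (z - a) ^ n a := by
        refine Finset.prod_congr rfl fun a ha => ?_
        rw [Function.update_of_ne]
        rintro rfl; exact hb ha
      rw [this]
      simp; ring

/-- log-derivative Lipschitz bound for a zero-free function -/
lemma xiaux_zerofree (g : ℂ → ℂ) (hg : Differentiable ℂ g) (R M : ℝ) (hR : 0 < R) (hM : 0 < M)
    (hne : ∀ z, ‖z‖ ≤ R → g z ≠ 0) (hb : ∀ z, ‖z‖ < R → ‖g z‖ ≤ ‖g 0‖ * Real.exp M)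
    (s t : ℂ) (hs : ‖s‖ ≤ R / 4) (ht : ‖t‖ ≤ R / 4) :
    ‖logDeriv g s - logDeriv g t‖ ≤ 64 * M / R ^ 2 * ‖s - t‖ := by
  have hdg : Differentiable ℂ (deriv g) := by
    rw [← differentiableOn_univ] at hg ⊢
    exact hg.deriv isOpen_univ
  have hld : DifferentiableOn ℂ (logDeriv g) (Metric.ball 0 R) := by
    intro z hz
    have : g z ≠ 0 := hne z (by simpa using (mem_ball_zero_iff.1 hz).le)
    exact ((hdg z).div (hg z) this).differentiableWithinAt
  obtain ⟨L, hL0, hL⟩ := hld.isExactOn_ball.with_val_at 0 0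
  have hLd : DifferentiableOn ℂ L (Metric.ball 0 R) := fun z hz =>
    (hL z hz).differentiableAt.differentiableWithinAt
  have h0R : (0 : ℂ) ∈ Metric.ball (0 : ℂ) R := Metric.mem_ball_self hR
  have hg0 : g 0 ≠ 0 := hne 0 (by simpa using hR.le)
  have hexp : ∀ z ∈ Metric.ball (0 : ℂ) R, g z = g 0 * Complex.exp (L z) := by
    have hk : ∀ z ∈ Metric.ball (0 : ℂ) R,
        HasDerivAt (fun z => g z * Complex.exp (-L z)) 0 z := by
      intro z hz
      have h1 := (hg z).hasDerivAt.mul ((hL z hz).neg.cexp)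
      have : g z ≠ 0 := hne z (by simpa using (mem_ball_zero_iff.1 hz).le)
      have e : deriv g z * Complex.exp ((-L) z) +
          g z * (Complex.exp ((-L) z) * -logDeriv g z) = 0 := by
        rw [logDeriv_apply]
        field_simp
        ring
      rw [e] at h1
      exact h1
    intro z hz
    have hc := (convex_ball (0 : ℂ) R).is_const_of_fderivWithin_eq_zero (𝕜 := ℂ)
      (f := fun z => g z * Complex.exp (-L z))
      (fun z hz => (hk z hz).differentiableAt.differentiableWithinAt)
      (fun z hz => by
        rw [fderivWithin_of_isOpen Metric.isOpen_ball hz]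
        have := (hk z hz).hasFDerivAt.fderiv
        rw [this]; ext; simp) hz h0R
    simp only [hL0, neg_zero, Complex.exp_zero, mul_one] at hc
    rw [← hc, mul_assoc, ← Complex.exp_add]; simp
  have hre : Set.MapsTo L (Metric.ball 0 R) {z | z.re ≤ M} := by
    intro z hz
    have h1 := hb z (mem_ball_zero_iff.1 hz)
    rw [hexp z hz, norm_mul, Complex.norm_exp] at h1
    have h2 := le_of_mul_le_mul_left h1 (norm_pos_iff.2 hg0)
    exact Real.exp_le_exp.1 h2
  have hLb : ∀ z, ‖z‖ ≤ R / 2 → ‖L z‖ ≤ 2 * M := by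
    intro z hz
    have hz' : z ∈ Metric.ball (0 : ℂ) R := by rw [mem_ball_zero_iff]; linarith
    refine (Complex.borelCaratheodory_zero hM hLd hre hR hz' hL0).trans ?_
    rw [div_le_iff₀ (by linarith)]
    nlinarith [norm_nonneg z]
  have hsub : ∀ c : ℂ, ‖c‖ ≤ R / 4 → Metric.closedBall c (R / 4) ⊆ Metric.closedBall 0 (R / 2) := by
    intro c hc z hz
    rw [mem_closedBall_iff_norm] at hz
    rw [mem_closedBall_zero_iff]
    have := norm_sub_norm_le z c
    linarith
  have hsub2 : Metric.closedBall (0 : ℂ) (R / 2) ⊆ Metric.ball 0 R :=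
    Metric.closedBall_subset_ball (by linarith)
  have hL2 : ∀ c : ℂ, ‖c‖ ≤ R / 4 → ‖deriv (logDeriv g) c‖ ≤ 64 * M / R ^ 2 := by
    intro c hc
    have hcb : c ∈ Metric.ball (0 : ℂ) R := by rw [mem_ball_zero_iff]; linarith
    have h1 := Complex.norm_iteratedDeriv_le_of_forall_mem_sphere_norm_le (f := L) (c := c)
      (R := R / 4) (C := 2 * M) 2 (by linarith)
      ((hLd.mono ((hsub c hc).trans hsub2)).diffContOnCl_ball subset_rfl)
      (fun z hz => hLb z (mem_closedBall_zero_iff.1 (hsub c hc (Metric.sphere_subset_closedBall hz))))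
    have h2 : iteratedDeriv 2 L c = deriv (logDeriv g) c := by
      rw [iteratedDeriv_succ, iteratedDeriv_one]
      apply Filter.EventuallyEq.deriv_eq
      filter_upwards [Metric.isOpen_ball.mem_nhds hcb] with z hz
      exact (hL z hz).deriv
    rw [h2] at h1
    refine h1.trans (le_of_eq ?_)
    simp [Nat.factorial]
    field_simp
    norm_num
  refine (convex_closedBall (0 : ℂ) (R / 4)).norm_image_sub_le_of_norm_deriv_le (f := logDeriv g)
    (𝕜 := ℂ) ?_ ?_ ?_ ?_
  · intro z hz
    rw [mem_closedBall_zero_iff] at hz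
    exact hld.differentiableAt (Metric.isOpen_ball.mem_nhds (by rw [mem_ball_zero_iff]; linarith))
  · intro z hz; exact hL2 z (mem_closedBall_zero_iff.1 hz)
  · simpa using ht
  · simpa using hs

lemma xiaux_key (f : ℂ → ℂ) (hf : Differentiable ℂ f) (h0 : f 0 ≠ 0) (R M : ℝ) (hR : 0 < R)
    (hM : 0 < M) (hb : ∀ z, ‖z‖ ≤ 2 * R → ‖f z‖ ≤ ‖f 0‖ * Real.exp M) :
    ∃ (Z : Finset ℂ) (n : ℂ → ℕ), (∀ a ∈ Z, f a = 0 ∧ n a ≠ 0) ∧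
      (∀ a, f a = 0 → ‖a‖ ≤ R → a ∈ Z) ∧
      ∀ s t : ℂ, ‖s‖ ≤ R / 4 → ‖t‖ ≤ R / 4 → f s ≠ 0 → f t ≠ 0 →
        ‖(logDeriv f s - ∑ a ∈ Z, (n a : ℂ) / (s - a)) -
          (logDeriv f t - ∑ a ∈ Z, (n a : ℂ) / (t - a))‖ ≤ 64 * M / R ^ 2 * ‖s - t‖ := by
  classical
  have hfin : (Metric.closedBall (0 : ℂ) R ∩ {z | f z = 0}).Finite := by
    by_contra hinf
    obtain ⟨x, hx, hacc⟩ := Set.Infinite.exists_accPt_of_subset_isCompact hinf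
      (isCompact_closedBall (0 : ℂ) R) Set.inter_subset_left
    have h1 : ∃ᶠ z in nhdsWithin x {x}ᶜ, f z = (fun _ => (0 : ℂ)) z := by
      rw [accPt_iff_frequently_nhdsNE] at hacc
      exact hacc.mono fun z hz => hz.2
    have h2 := AnalyticOnNhd.eq_of_frequently_eq (f := f) (g := fun _ => 0)
        (fun z _ => hf.analyticAt z) (fun z _ => analyticAt_const) h1
    exact h0 (congrFun h2 0)
  set Z := hfin.toFinset with hZ
  have hmem : ∀ a, a ∈ Z ↔ ‖a‖ ≤ R ∧ f a = 0 := by intro a; simp [hZ]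
  obtain ⟨n, g, hg, hgZ, hfg⟩ := xiaux_factor f hf h0 Z
  have hgne : ∀ z, ‖z‖ ≤ R → g z ≠ 0 := by
    intro z hz h
    have hfz : f z = 0 := by rw [hfg, h, mul_zero]
    exact hgZ z ((hmem z).2 ⟨hz, hfz⟩) h
  have hgb : ∀ z ∈ Metric.closedBall (0 : ℂ) (2 * R), ‖g z‖ ≤ ‖g 0‖ * Real.exp M := by
    intro z hz
    refine Complex.norm_le_of_forall_mem_frontier_norm_le (f := g)
      (U := Metric.ball (0 : ℂ) (2 * R)) Metric.isBounded_ball hg.diffContOnCl ?_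
      (by rwa [closure_ball _ (by positivity)])
    intro w hw
    rw [frontier_ball _ (by positivity), mem_sphere_zero_iff_norm] at hw
    have h1 := hb w hw.le
    rw [hfg w, hfg 0, norm_mul, norm_mul] at h1
    have hP0 : ‖∏ a ∈ Z, ((0 : ℂ) - a) ^ n a‖ ≤ ‖∏ a ∈ Z, (w - a) ^ n a‖ := by
      rw [norm_prod, norm_prod]
      refine Finset.prod_le_prod (fun _ _ => norm_nonneg _) fun a ha => ?_
      rw [norm_pow, norm_pow]
      gcongr
      have := norm_sub_norm_le w a
      have := ((hmem a).1 ha).1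
      rw [zero_sub, norm_neg]
      linarith
    have hPpos : 0 < ‖∏ a ∈ Z, ((0 : ℂ) - a) ^ n a‖ := by
      rw [norm_pos_iff]
      intro h
      exact h0 (by rw [hfg, h, zero_mul])
    have h2 : ‖∏ a ∈ Z, ((0 : ℂ) - a) ^ n a‖ * ‖g w‖ ≤
        ‖∏ a ∈ Z, ((0 : ℂ) - a) ^ n a‖ * (‖g 0‖ * Real.exp M) := by
      calc _ ≤ _ := mul_le_mul_of_nonneg_right hP0 (norm_nonneg _)
        _ ≤ _ := h1
        _ = _ := by ring
    exact le_of_mul_le_mul_left h2 hPpos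
  have hlog : ∀ s, f s ≠ 0 → logDeriv f s - ∑ a ∈ Z, (n a : ℂ) / (s - a) = logDeriv g s := by
    intro s hs
    have hs' := hs
    rw [hfg] at hs'
    have hgs := right_ne_zero_of_mul hs'
    have hPs := left_ne_zero_of_mul hs'
    have hPa := Finset.prod_ne_zero_iff.1 hPs
    have e : f = fun z => (∏ a ∈ Z, (z - a) ^ n a) * g z := funext hfg
    have h1 : logDeriv f s = logDeriv (fun z => ∏ a ∈ Z, (z - a) ^ n a) s + logDeriv g s := by
      conv_lhs => rw [e]
      exact logDeriv_mul (f := fun z => ∏ a ∈ Z, (z - a) ^ n a) (g := g) s hPs hgs (by fun_prop) (hg s)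
    have h2 : logDeriv (fun z => ∏ a ∈ Z, (z - a) ^ n a) s = ∑ a ∈ Z, (n a : ℂ) / (s - a) := by
      rw [logDeriv_prod (hf := hPa) (hd := fun _ _ => by fun_prop)]
      refine Finset.sum_congr rfl fun a ha => ?_
      rw [logDeriv_fun_pow (by fun_prop), logDeriv_apply]
      simp [div_eq_mul_inv]
    rw [h1, h2]; ring
  refine ⟨Z, n, ?_, ?_, ?_⟩
  · intro a ha
    have hfa := ((hmem a).1 ha).2
    refine ⟨hfa, fun hna => ?_⟩
    rw [hfg] at hfa
    have := (mul_eq_zero.1 hfa).resolve_right (hgZ a ha)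
    obtain ⟨b, hb, hb0⟩ := Finset.prod_eq_zero_iff.1 this
    by_cases hnb : n b = 0
    · simp [hnb] at hb0
    · have := (pow_eq_zero_iff hnb).1 hb0
      have : a = b := sub_eq_zero.1 this
      subst this
      exact hnb hna
  · intro a h1 h2
    exact (hmem a).2 ⟨h2, h1⟩
  · intro s t hs ht hfs hft
    rw [hlog s hfs, hlog t hft]
    exact xiaux_zerofree g hg R M hR hM hgne
      (fun z hz => hgb z (by rw [mem_closedBall_zero_iff]; linarith)) s t hs ht

lemma xiaux_main (f : ℂ → ℂ) (hf : Differentiable ℂ f) (h0 : f 0 ≠ 0)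
    (hgr : ∀ ε > (0 : ℝ), ∀ R₀ : ℝ, ∃ R ≥ R₀, 0 < R ∧ ∃ M > (0 : ℝ), M ≤ ε * R ^ 2 ∧
      ∀ z, ‖z‖ ≤ 2 * R → ‖f z‖ ≤ ‖f 0‖ * Real.exp M)
    (hsym : ∀ z, f (1 - (starRingEnd ℂ) z) = (starRingEnd ℂ) (f z))
    (hz : ∀ z, f z = 0 → z.re = 1 / 2) (hnc : ∃ w, f w ≠ f 0)
    (s : ℂ) (hs : deriv f s = 0) : s.re = 1 / 2 := by
  by_contra hre
  have hfs : f s ≠ 0 := fun h => hre (hz s h)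
  have hls : logDeriv f s = 0 := by rw [logDeriv_apply, hs, zero_div]
  by_cases hex : ∃ a, f a = 0
  · obtain ⟨a₁, ha₁⟩ := hex
    set t := 1 - (starRingEnd ℂ) s with ht
    have hft : f t ≠ 0 := by
      rw [ht, hsym]; simpa using hfs
    have hdt : deriv f t = 0 := by
      have e : f = fun z => (starRingEnd ℂ) (f ((starRingEnd ℂ) (1 - z))) := by
        ext z
        rw [← hsym]; simp
      have h1 : HasDerivAt f 0 s := hs ▸ (hf s).hasDerivAt
      have h2 : HasDerivAt (fun z => (starRingEnd ℂ) (f ((starRingEnd ℂ) z)))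
          0 ((starRingEnd ℂ) s) := by
        have := HasDerivAt.conj_conj (f := f) (x := s) (f' := 0) h1
        simpa [Function.comp_def] using this
      have h3 : HasDerivAt (fun z => (starRingEnd ℂ) (f ((starRingEnd ℂ) (1 - z)))) 0 t := by
        have h4 : HasDerivAt (fun z : ℂ => 1 - z) (-1) t := by
          simpa using (hasDerivAt_id t).const_sub 1
        have := HasDerivAt.comp t (h₂ := fun z => (starRingEnd ℂ) (f ((starRingEnd ℂ) z)))
          (h := fun z => 1 - z) (h₂' := 0) (by simpa [ht] using h2) h4
        simpa [Function.comp_def] using this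
      rw [← e] at h3
      exact h3.deriv
    have hlt : logDeriv f t = 0 := by rw [logDeriv_apply, hdt, zero_div]
    set d := s.re - 1 / 2 with hd
    have hd0 : d ≠ 0 := fun h => hre (by linarith)
    have hst : s - t = ((2 * d : ℝ) : ℂ) := by
      apply Complex.ext <;> simp [ht, hd]; ring
    have hsa : s ≠ a₁ := fun h => hfs (h ▸ ha₁)
    have hpos : 0 < Complex.normSq (s - a₁) := Complex.normSq_pos.2 (sub_ne_zero.2 hsa)
    obtain ⟨R, hRR, hR, M, hM, hMR, hb⟩ := hgr (1 / (128 * Complex.normSq (s - a₁))) (by positivity)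
      (max ‖a₁‖ (max (4 * ‖s‖) (4 * ‖t‖)))
    obtain ⟨Z, n, hZ1, hZ2, hZ3⟩ := xiaux_key f hf h0 R M hR hM hb
    have hR1 : ‖a₁‖ ≤ R := (le_max_left _ _).trans hRR
    have hR2 : 4 * ‖s‖ ≤ R := ((le_max_left _ _).trans (le_max_right _ _)).trans hRR
    have hR3 : 4 * ‖t‖ ≤ R := ((le_max_right _ _).trans (le_max_right _ _)).trans hRR
    have hk := hZ3 s t (by linarith) (by linarith) hfs hft
    rw [hls, hlt, hst] at hk
    have hsum : ((0 - ∑ a ∈ Z, (n a : ℂ) / (s - a)) - (0 - ∑ a ∈ Z, (n a : ℂ) / (t - a))).re =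
        -(2 * d) * ∑ a ∈ Z, (n a : ℝ) / Complex.normSq (s - a) := by
      simp only [zero_sub, Complex.sub_re, Complex.neg_re, Complex.re_sum]
      rw [sub_neg_eq_add, neg_add_eq_sub, ← Finset.sum_sub_distrib, Finset.mul_sum]
      refine Finset.sum_congr rfl fun a ha => ?_
      have har := hz a (hZ1 a ha).1
      have e1 : t - a = -(starRingEnd ℂ) (s - a) := by
        apply Complex.ext <;> simp [ht, har] <;> ring
      rw [e1, Complex.div_re, Complex.div_re, Complex.normSq_neg, Complex.normSq_conj]
      simp [har, hd]
      ring
    have habs := (Complex.abs_re_le_norm _).trans hk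
    rw [hsum, abs_mul, abs_neg, Complex.norm_real, Real.norm_eq_abs, mul_comm] at habs
    have h5 := le_of_mul_le_mul_right habs (by positivity)
    have h6 : 1 / Complex.normSq (s - a₁) ≤ ∑ a ∈ Z, (n a : ℝ) / Complex.normSq (s - a) := by
      have hm := hZ2 a₁ ha₁ hR1
      refine le_trans ?_ (Finset.single_le_sum (f := fun a => (n a : ℝ) / Complex.normSq (s - a))
        (fun a _ => div_nonneg (Nat.cast_nonneg _) (Complex.normSq_nonneg _)) hm)
      have : (1 : ℝ) ≤ n a₁ := by exact_mod_cast Nat.one_le_iff_ne_zero.2 (hZ1 a₁ hm).2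
      gcongr
    have h7 := h6.trans ((le_abs_self _).trans h5)
    have h8 : 64 * M / R ^ 2 ≤ 1 / (2 * Complex.normSq (s - a₁)) := by
      rw [div_le_iff₀ (by positivity)]
      calc 64 * M ≤ 64 * (1 / (128 * Complex.normSq (s - a₁)) * R ^ 2) := by linarith
        _ = _ := by field_simp; norm_num
    have h9 : 1 / (2 * Complex.normSq (s - a₁)) = (1 / Complex.normSq (s - a₁)) / 2 := by
      field_simp
    have h10 : 0 < 1 / Complex.normSq (s - a₁) := by positivity
    linarith
  · push Not at hex
    have hd : ∀ t, deriv f t = 0 := by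
      intro t
      have hlt : ∀ ε > (0 : ℝ), ‖logDeriv f t‖ ≤ 0 + ε := by
        intro ε hε
        obtain ⟨R, hRR, hR, M, hM, hMR, hb⟩ := hgr (ε / (64 * (‖s - t‖ + 1))) (by positivity)
          (max (4 * ‖s‖) (4 * ‖t‖))
        obtain ⟨Z, n, hZ1, hZ2, hZ3⟩ := xiaux_key f hf h0 R M hR hM hb
        have hZe : Z = ∅ := Finset.eq_empty_of_forall_notMem fun a ha => hex a (hZ1 a ha).1
        have hR2 : 4 * ‖s‖ ≤ R := (le_max_left _ _).trans hRR
        have hR3 : 4 * ‖t‖ ≤ R := (le_max_right _ _).trans hRR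
        have hk := hZ3 s t (by linarith) (by linarith) (hex s) (hex t)
        rw [hZe, hls] at hk
        simp only [Finset.sum_empty, sub_zero, zero_sub, norm_neg] at hk
        have h8 : 64 * M / R ^ 2 ≤ ε / (‖s - t‖ + 1) := by
          rw [div_le_iff₀ (by positivity)]
          calc 64 * M ≤ 64 * (ε / (64 * (‖s - t‖ + 1)) * R ^ 2) := by linarith
            _ = _ := by field_simp
        calc _ ≤ _ := hk
          _ ≤ ε / (‖s - t‖ + 1) * (‖s - t‖ + 1) := by gcongr; linarith
          _ = 0 + ε := by field_simp; ring
      have h1 : logDeriv f t = 0 := by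
        have := le_of_forall_pos_le_add hlt
        simpa using this
      rw [logDeriv_apply] at h1
      exact (div_eq_zero_iff.1 h1).resolve_right (hex t)
    obtain ⟨w, hw⟩ := hnc
    exact hw (is_const_of_deriv_eq_zero hf hd w 0)

lemma xiaux_kernel_ge (x : ℝ) (hx : 0 < x) : 1 ≤ HurwitzZeta.evenKernel 0 x := by
  have h := HurwitzZeta.hasSum_int_evenKernel 0 hx
  have h1 := le_hasSum h 0 (fun j _ => (Real.exp_pos _).le)
  simpa using h1

lemma xiaux_fmodif (x : ℝ) (hx : 0 < x) :
    (HurwitzZeta.hurwitzEvenFEPair 0).f_modif x =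
      ((‖(HurwitzZeta.hurwitzEvenFEPair 0).f_modif x‖ : ℝ) : ℂ) := by
  have key : ∃ r : ℝ, 0 ≤ r ∧ (HurwitzZeta.hurwitzEvenFEPair 0).f_modif x = (r : ℂ) := by
    rcases lt_trichotomy 1 x with h | h | h
    · refine ⟨HurwitzZeta.evenKernel 0 x - 1, by linarith [xiaux_kernel_ge x hx], ?_⟩
      simp [WeakFEPair.f_modif, HurwitzZeta.hurwitzEvenFEPair, h, not_lt.2 h.le]
    · refine ⟨0, le_rfl, ?_⟩
      simp [WeakFEPair.f_modif, ← h]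
    · refine ⟨HurwitzZeta.evenKernel 0 x - x ^ (-(1 / 2) : ℝ), ?_, ?_⟩
      · rw [HurwitzZeta.evenKernel_functional_equation, ← HurwitzZeta.evenKernel_eq_cosKernel_of_zero,
          Real.rpow_neg hx.le]
        have := xiaux_kernel_ge (1 / x) (by positivity)
        have h2 : 0 < x ^ (1 / 2 : ℝ) := by positivity
        rw [one_div (x ^ (1 / 2 : ℝ))]
        have h3 : 0 < (x ^ (1 / 2 : ℝ))⁻¹ := by positivity
        nlinarith
      · simp [WeakFEPair.f_modif, HurwitzZeta.hurwitzEvenFEPair, h, not_lt.2 h.le, hx]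
  obtain ⟨r, hr, h⟩ := key
  rw [h, Complex.norm_real, Real.norm_of_nonneg hr]

open MeasureTheory Set in
lemma xiaux_zeta0 (n : ℕ) (s : ℂ) (hs : ‖s‖ ≤ 2 * n - 1) :
    ‖completedRiemannZeta₀ s‖ ≤ 2 * ‖completedRiemannZeta₀ (2 * n)‖ := by
  set F := (HurwitzZeta.hurwitzEvenFEPair 0).f_modif with hF
  have hΛ : ∀ z, completedRiemannZeta₀ z = mellin F (z / 2) / 2 := fun z => rfl
  have hconv : ∀ z : ℂ, IntegrableOn (fun t : ℝ => (t : ℂ) ^ (z - 1) • F t) (Ioi 0) := fun z =>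
    ((HurwitzZeta.hurwitzEvenFEPair 0).isStrongFEPair_toStrongFEPair.hasMellin z).1
  have hnorm : ∀ z : ℂ, ∀ t ∈ Ioi (0 : ℝ),
      ‖(t : ℂ) ^ (z - 1) • F t‖ = t ^ (z.re - 1) * ‖F t‖ := by
    intro z t ht
    rw [norm_smul, Complex.norm_cpow_eq_rpow_re_of_pos ht]; simp
  have hint : ∀ a : ℝ, IntegrableOn (fun t : ℝ => t ^ (a - 1) * ‖F t‖) (Ioi 0) := by
    intro a
    refine IntegrableOn.congr_fun (hconv a).norm (fun t ht => ?_) measurableSet_Ioi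
    have := hnorm a t ht
    simpa using this
  have hreal : ∀ a : ℝ, ‖mellin F a‖ = ∫ t in Ioi (0 : ℝ), t ^ (a - 1) * ‖F t‖ := by
    intro a
    have : mellin F a = ((∫ t in Ioi (0 : ℝ), t ^ (a - 1) * ‖F t‖ : ℝ) : ℂ) := by
      rw [mellin, ← integral_complex_ofReal]
      refine setIntegral_congr_fun measurableSet_Ioi fun t ht => ?_
      have ht' : (0 : ℝ) < t := ht
      simp only [smul_eq_mul]
      have hFt : F t = ((‖F t‖ : ℝ) : ℂ) := xiaux_fmodif t ht'
      rw [Complex.ofReal_mul, ← hFt, Complex.ofReal_cpow ht'.le]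
      simp
    rw [this, Complex.norm_real, Real.norm_of_nonneg]
    exact setIntegral_nonneg measurableSet_Ioi fun t ht => by
      have ht' : (0 : ℝ) < t := ht
      positivity
  have hre := (abs_le.1 ((Complex.abs_re_le_norm s).trans hs))
  have hb : ‖mellin F (s / 2)‖ ≤ ‖mellin F ((n : ℝ) : ℂ)‖ + ‖mellin F (((1 / 2 - n : ℝ)) : ℂ)‖ := by
    rw [hreal, hreal, ← integral_add (hint _) (hint _), mellin]
    refine norm_integral_le_of_norm_le ((hint _).add (hint _)) ?_
    rw [ae_restrict_iff' measurableSet_Ioi]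
    refine Filter.Eventually.of_forall fun t ht => ?_
    have ht' : (0 : ℝ) < t := ht
    rw [hnorm _ t ht, ← add_mul]
    refine mul_le_mul_of_nonneg_right ?_ (norm_nonneg _)
    have hsre : (s / 2).re = s.re / 2 := by simp
    rw [hsre]
    rcases le_total 1 t with h1 | h1
    · have := Real.rpow_le_rpow_of_exponent_le h1 (show s.re / 2 - 1 ≤ (n : ℝ) - 1 by linarith)
      have h2 : 0 ≤ t ^ ((1 / 2 - n : ℝ) - 1) := by positivity
      linarith
    · have := Real.rpow_le_rpow_of_exponent_ge ht' h1
        (show (1 / 2 - n : ℝ) - 1 ≤ s.re / 2 - 1 by linarith)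
      have h2 : 0 ≤ t ^ ((n : ℝ) - 1) := by positivity
      linarith
  have e1 : mellin F ((n : ℝ) : ℂ) / 2 = completedRiemannZeta₀ (2 * n) := by
    rw [hΛ]; simp
  have e2 : mellin F ((1 / 2 - n : ℝ) : ℂ) / 2 = completedRiemannZeta₀ (2 * n) := by
    rw [← completedRiemannZeta₀_one_sub, hΛ]
    congr 2
    push_cast; ring
  have e1' := congrArg norm e1
  have e2' := congrArg norm e2
  rw [norm_div, Complex.norm_two] at e1' e2'
  rw [hΛ s, norm_div, Complex.norm_two]
  linarith

lemma xiaux_zeta_even (n : ℕ) (hn : 1 ≤ n) : ‖riemannZeta (2 * n)‖ ≤ 2 := by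
  have h1 := zeta_nat_eq_tsum_of_gt_one (k := 2 * n) (by omega)
  push_cast at h1
  rw [h1]
  have h2 : HasSum (fun k : ℕ => 1 / (k : ℝ) ^ 2) (Real.pi ^ 2 / 6) := hasSum_zeta_two
  have h3 : ‖∑' k : ℕ, 1 / (k : ℂ) ^ (2 * n)‖ ≤ Real.pi ^ 2 / 6 := by
    refine tsum_of_norm_bounded h2 fun k => ?_
    rw [norm_div, norm_pow, Complex.norm_natCast, norm_one]
    rcases Nat.eq_zero_or_pos k with rfl | hk
    · have : 2 * n ≠ 0 := by omega
      simp [this]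
    · have : (1 : ℝ) ≤ k := by exact_mod_cast hk
      refine one_div_le_one_div_of_le (by positivity) (pow_le_pow_right₀ this (by omega))
  refine h3.trans ?_
  nlinarith [Real.pi_lt_d2, Real.pi_pos]

lemma xiaux_zeta0_even (n : ℕ) (hn : 1 ≤ n) :
    ‖completedRiemannZeta₀ (2 * n)‖ ≤ 4 * (n : ℝ) ^ n := by
  have hn0 : (n : ℂ) ≠ 0 := by exact_mod_cast (by omega : n ≠ 0)
  have hnr : (1 : ℝ) ≤ n := by exact_mod_cast hn
  have h1 := completedRiemannZeta_eq (2 * n)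
  have h2 := riemannZeta_def_of_ne_zero (s := 2 * n) (by simp [hn0])
  have hG : Complex.Gammaℝ (2 * n) ≠ 0 :=
    Complex.Gammaℝ_ne_zero_of_re_pos (by simp; omega)
  rw [eq_div_iff hG] at h2
  have h3 : completedRiemannZeta₀ (2 * n) =
      riemannZeta (2 * n) * Complex.Gammaℝ (2 * n) + 1 / (2 * n) + 1 / (1 - 2 * n) := by
    rw [h2, h1]; ring
  have hGb : ‖Complex.Gammaℝ (2 * n)‖ ≤ (n : ℝ) ^ n := by
    rw [Complex.Gammaℝ_def, norm_mul, Complex.norm_cpow_eq_rpow_re_of_pos Real.pi_pos]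
    have e : (2 * n / 2 : ℂ) = (n - 1 : ℕ) + 1 := by
      rw [Nat.cast_sub hn]; push_cast; ring
    rw [e, Complex.Gamma_nat_eq_factorial, Complex.norm_natCast]
    have e2 : (-(2 * n : ℂ) / 2).re = -n := by
      have : (-(2 * n : ℂ) / 2) = ((-n : ℝ) : ℂ) := by push_cast; ring
      rw [this, Complex.ofReal_re]
    rw [e2]
    have a1 : Real.pi ^ (-n : ℝ) ≤ 1 :=
      Real.rpow_le_one_of_one_le_of_nonpos (by linarith [Real.pi_gt_three]) (by linarith)
    have a2 : ((n - 1).factorial : ℝ) ≤ (n : ℝ) ^ n := by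
      exact_mod_cast (Nat.factorial_le (Nat.sub_le n 1)).trans (Nat.factorial_le_pow n)
    calc _ ≤ 1 * (n : ℝ) ^ n := by gcongr
      _ = _ := one_mul _
  have hpow : (1 : ℝ) ≤ (n : ℝ) ^ n := one_le_pow₀ hnr
  have b1 : ‖(1 / (2 * n) : ℂ)‖ ≤ 1 := by
    rw [norm_div, norm_mul, Complex.norm_natCast, norm_one, Complex.norm_two]
    rw [div_le_one (by linarith)]; linarith
  have b2 : ‖(1 / (1 - 2 * n) : ℂ)‖ ≤ 1 := by
    have : (1 - 2 * n : ℂ) = ((1 - 2 * n : ℝ) : ℂ) := by push_cast; ring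
    rw [norm_div, this, Complex.norm_real, norm_one, Real.norm_of_nonpos (by linarith)]
    rw [div_le_one (by linarith)]; linarith
  rw [h3]
  calc _ ≤ ‖riemannZeta (2 * n)‖ * ‖Complex.Gammaℝ (2 * n)‖ + 1 + 1 := by
        refine (norm_add₃_le).trans ?_
        rw [norm_mul]; gcongr
    _ ≤ 2 * (n : ℝ) ^ n + 1 + 1 := by gcongr; exact xiaux_zeta_even n hn
    _ ≤ _ := by linarith

lemma xiaux_zero : riemannXi 0 = 1 / 2 := by simp [riemannXi]

lemma xiaux_growth (n : ℕ) (hn : 1 ≤ n) (s : ℂ) (hs : ‖s‖ ≤ 2 * n - 1) :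
    ‖riemannXi s‖ ≤ ‖riemannXi 0‖ * Real.exp (Real.log 40 + 3 * n * Real.log n) := by
  have hnr : (1 : ℝ) ≤ n := by exact_mod_cast hn
  have h1 := (xiaux_zeta0 n s hs).trans
    (mul_le_mul_of_nonneg_left (xiaux_zeta0_even n hn) (by norm_num))
  have e : Real.exp (Real.log 40 + 3 * n * Real.log n) = 40 * ((n : ℝ) ^ n) ^ 3 := by
    rw [Real.exp_add, Real.exp_log (by norm_num)]
    have : 3 * n * Real.log n = Real.log (((n : ℝ) ^ n) ^ 3) := by
      rw [Real.log_pow, Real.log_pow]; push_cast; ring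
    rw [this, Real.exp_log (by positivity)]
  rw [e, xiaux_zero]
  have hnn : (n : ℝ) ≤ (n : ℝ) ^ n := le_self_pow₀ hnr (by omega)
  set X := (n : ℝ) ^ n
  have hX : 1 ≤ X := hnr.trans hnn
  have hs1 : ‖s - 1‖ ≤ 2 * n := by
    have := norm_sub_le s 1
    rw [norm_one] at this
    linarith
  have : ‖riemannXi s‖ ≤ (2 * n) * (2 * n) / 2 * (2 * (4 * X)) + 1 / 2 := by
    unfold riemannXi
    refine (norm_add_le _ _).trans ?_
    have e3 : ‖(1 / 2 : ℂ)‖ = 1 / 2 := by simp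
    rw [e3, norm_mul, norm_div, norm_mul, Complex.norm_two]
    gcongr
    linarith
  refine this.trans ?_
  have e3 : ‖(1 / 2 : ℂ)‖ = 1 / 2 := by simp
  rw [e3]
  have h4 : (n : ℝ) * n * X ≤ X ^ 3 := by
    calc (n : ℝ) * n * X ≤ X * X * X := by gcongr
      _ = X ^ 3 := by ring
  have h5 : 1 ≤ X ^ 3 := one_le_pow₀ hX
  nlinarith

lemma xiaux_gr : ∀ ε > (0 : ℝ), ∀ R₀ : ℝ, ∃ R ≥ R₀, 0 < R ∧ ∃ M > (0 : ℝ), M ≤ ε * R ^ 2 ∧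
      ∀ z, ‖z‖ ≤ 2 * R → ‖riemannXi z‖ ≤ ‖riemannXi 0‖ * Real.exp M := by
  intro ε hε R₀
  have h1 := (Real.isLittleO_log_id_atTop.def (c := ε / 24) (by positivity))
  have h1' := tendsto_natCast_atTop_atTop (R := ℝ) |>.eventually h1
  have h2 := tendsto_natCast_atTop_atTop (R := ℝ) |>.eventually_ge_atTop (R₀ + 1)
  have h3 := tendsto_natCast_atTop_atTop (R := ℝ) |>.eventually_ge_atTop (8 * Real.log 40 / ε)
  obtain ⟨n, ⟨⟨hn1, hn2⟩, hn3⟩, hn4⟩ :=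
    (((h1'.and h2).and h3).and (Filter.eventually_ge_atTop 1)).exists
  have hnr : (1 : ℝ) ≤ n := by exact_mod_cast hn4
  have hlog : 0 ≤ Real.log n := Real.log_nonneg hnr
  have hl40 : 0 < Real.log 40 := Real.log_pos (by norm_num)
  refine ⟨n - 1 / 2, by linarith, by linarith, Real.log 40 + 3 * n * Real.log n, by positivity,
    ?_, fun z hz => xiaux_growth n hn4 z (by linarith)⟩
  simp only [id, Real.norm_eq_abs, abs_of_nonneg hlog, abs_of_nonneg (by linarith : (0 : ℝ) ≤ n)] at hn1
  have h5 : 3 * n * Real.log n ≤ ε / 8 * n ^ 2 := by nlinarith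
  have h6 : Real.log 40 ≤ ε / 8 * n ^ 2 := by
    rw [div_le_iff₀ hε] at hn3
    nlinarith
  have h7 : (n : ℝ) ^ 2 / 4 ≤ (n - 1 / 2 : ℝ) ^ 2 := by nlinarith
  nlinarith

lemma xiaux_one_sub (s : ℂ) : riemannXi (1 - s) = riemannXi s := by
  unfold riemannXi
  rw [completedRiemannZeta₀_one_sub]; ring

lemma xiaux_eq (s : ℂ) (h0 : s ≠ 0) (h1 : s ≠ 1) :
    riemannXi s = s * (s - 1) / 2 * completedRiemannZeta s := by
  unfold riemannXi
  rw [completedRiemannZeta_eq]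
  have : s - 1 ≠ 0 := sub_ne_zero.2 h1
  have h2 : 1 - s ≠ 0 := sub_ne_zero.2 h1.symm
  have h3 : (1 - s) = -(s - 1) := by ring
  rw [h3]
  field_simp
  ring

lemma xiaux_eq' (s : ℂ) (h0 : 0 < s.re) (h1 : s ≠ 1) :
    riemannXi s = s * (s - 1) / 2 * (riemannZeta s * Complex.Gammaℝ s) := by
  have hs0 : s ≠ 0 := by rintro rfl; simp at h0
  rw [xiaux_eq s hs0 h1, riemannZeta_def_of_ne_zero hs0,
    div_mul_cancel₀ _ (Complex.Gammaℝ_ne_zero_of_re_pos h0)]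

lemma xiaux_conj_pos (s : ℂ) (h0 : 0 < s.re) :
    riemannXi ((starRingEnd ℂ) s) = (starRingEnd ℂ) (riemannXi s) := by
  by_cases h1 : s = 1
  · subst h1; simp [riemannXi, map_ofNat]
  · have h1' : (starRingEnd ℂ) s ≠ 1 := by
      intro h; apply h1; simpa using congrArg (starRingEnd ℂ) h
    rw [xiaux_eq' s h0 h1, xiaux_eq' _ (by simpa using h0) h1', riemannZeta_conj]
    have hG : Complex.Gammaℝ ((starRingEnd ℂ) s) = (starRingEnd ℂ) (Complex.Gammaℝ s) := by
      rw [Complex.Gammaℝ_def, Complex.Gammaℝ_def, map_mul, ← Complex.Gamma_conj, map_div₀]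
      have : (Real.pi : ℂ).arg ≠ Real.pi := by
        rw [Complex.arg_ofReal_of_nonneg Real.pi_pos.le]; exact Real.pi_pos.ne
      have e : -(starRingEnd ℂ) s / 2 = (starRingEnd ℂ) (-s / 2) := by simp [map_ofNat]
      rw [e, Complex.cpow_conj _ _ this, Complex.conj_ofReal, map_ofNat]
    rw [hG]; simp [map_ofNat]

lemma xiaux_conj (s : ℂ) : riemannXi ((starRingEnd ℂ) s) = (starRingEnd ℂ) (riemannXi s) := by
  by_cases h : 0 < s.re
  · exact xiaux_conj_pos s h
  · have := xiaux_conj_pos (1 - s) (by simp; linarith)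
    rwa [map_sub, map_one, xiaux_one_sub, xiaux_one_sub] at this

lemma xiaux_ne_zero_of_one_le (s : ℂ) (h : 1 ≤ s.re) : riemannXi s ≠ 0 := by
  by_cases h1 : s = 1
  · subst h1; simp [riemannXi]
  have hs0 : s ≠ 0 := by rintro rfl; norm_num at h
  rw [xiaux_eq' s (by linarith) h1]
  have := riemannZeta_ne_zero_of_one_le_re h
  have := Complex.Gammaℝ_ne_zero_of_re_pos (show 0 < s.re by linarith)
  have := sub_ne_zero.2 h1
  simp_all

lemma xiaux_zeros (hRH : RiemannHypothesis) (s : ℂ) (hs : riemannXi s = 0) : s.re = 1 / 2 := by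
  have ha : s.re < 1 := by
    by_contra h
    exact xiaux_ne_zero_of_one_le s (not_lt.1 h) hs
  have hb : 0 < s.re := by
    by_contra h
    refine xiaux_ne_zero_of_one_le (1 - s) ?_ (by rw [xiaux_one_sub, hs])
    simp; linarith
  have h1 : s ≠ 1 := by rintro rfl; simp at ha
  have hs0 : s ≠ 0 := by rintro rfl; simp at hb
  rw [xiaux_eq' s hb h1] at hs
  have hG := Complex.Gammaℝ_ne_zero_of_re_pos hb
  have h2 := sub_ne_zero.2 h1
  have hz : riemannZeta s = 0 := by simp_all
  refine hRH s hz ?_ h1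
  rintro ⟨n, rfl⟩
  have : (-2 * ((n : ℂ) + 1)).re = -2 * (n + 1) := by simp
  rw [this] at hb
  have : (0 : ℝ) ≤ n := Nat.cast_nonneg n
  linarith

lemma xiaux_two : riemannXi 2 ≠ riemannXi 0 := by
  rw [xiaux_zero, xiaux_eq' 2 (by norm_num) (by norm_num), riemannZeta_two, Complex.Gammaℝ_def]
  have e1 : (-2 / 2 : ℂ) = -1 := by norm_num
  have e2 : (2 / 2 : ℂ) = 1 := by norm_num
  rw [e1, e2, Complex.Gamma_one, Complex.cpow_neg_one]
  intro h
  have hpi : (Real.pi : ℂ) ≠ 0 := by exact_mod_cast Real.pi_ne_zero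
  field_simp at h
  have h' : (Real.pi : ℂ) = 3 := by linear_combination (1 / 2) * h
  have h2 : Real.pi = 3 := by exact_mod_cast h'
  linarith [Real.pi_gt_three]

theorem zeros_of_deriv_xi_on_critical_line (hRH : RiemannHypothesis)
    (s : ℂ) (h : deriv riemannXi s = 0) : s.re = 1 / 2 := by
  refine xiaux_main riemannXi ?_ ?_ xiaux_gr ?_ (xiaux_zeros hRH) ⟨2, xiaux_two⟩ s h
  · unfold riemannXi
    have := differentiable_completedZeta₀
    fun_prop
  · rw [xiaux_zero]; norm_num
  · intro z
    rw [xiaux_one_sub, xiaux_conj]
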